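/- Let X : ℝ² → ℝ³ be the timelike Enneper surface X(u,v) = ( e^{2u}·cosh(2v) , e^u(3·cosh v − e^{2u}·cosh(3v))/3 , e^u(3·sinh v + e^{2u}·sinh(3v))/3 ), and define the unit normal N(u,v) = (X_u ×_L X_v)/(e^{2u}(1+e^{2u})²). Then for all (u,v) ∈ ℝ²: ⟨N, N⟩ = 1, ⟨N, X_u⟩ = ⟨N, X_v⟩ = 0, and the second fundamental form coefficients are ⟨X_{uu}, N⟩ = 2e^{2u}·cosh(2v), ⟨X_{uv}, N⟩ = 2e^{2u}·sinh(2v), ⟨X_{vv}, N⟩ = 2e^{2u}·cosh(2v). (Equivalently, the Weingarten matrix with respect to (X_u, X_v) is G_{−v}·diag(2/(e^{2u}+1)², −2/(e^{2u}+1)²)·G_v, where G_v is the hyperbolic rotation of angle v.) -/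

import Mathlib

noncomputable section

open Real

/-- The Lorentzian inner product on `ℝ³ = ℝ × ℝ × ℝ`:
`⟨x, y⟩ = x₁y₁ + x₂y₂ − x₃y₃`. -/
def lint (x y : ℝ × ℝ × ℝ) : ℝ := x.1 * y.1 + x.2.1 * y.2.1 - x.2.2 * y.2.2

/-- The Lorentzian cross product on `ℝ³`, characterized by `⟨x ×_L y, z⟩ = det(x,y,z)`. -/
def lcross (x y : ℝ × ℝ × ℝ) : ℝ × ℝ × ℝ :=
  (x.2.1 * y.2.2 - x.2.2 * y.2.1,
   x.2.2 * y.1 - x.1 * y.2.2,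
   x.2.1 * y.1 - x.1 * y.2.1)

/-- Partial derivative with respect to the first variable. -/
def pu (X : ℝ → ℝ → ℝ × ℝ × ℝ) (u v : ℝ) : ℝ × ℝ × ℝ := deriv (fun t => X t v) u

/-- Partial derivative with respect to the second variable. -/
def pv (X : ℝ → ℝ → ℝ × ℝ × ℝ) (u v : ℝ) : ℝ × ℝ × ℝ := deriv (fun t => X u t) v

/-- The timelike Enneper surface. -/
def EnneperT (u v : ℝ) : ℝ × ℝ × ℝ :=
  (Real.exp (2 * u) * Real.cosh (2 * v),
   Real.exp u * (3 * Real.cosh v - Real.exp (2 * u) * Real.cosh (3 * v)) / 3,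
   Real.exp u * (3 * Real.sinh v + Real.exp (2 * u) * Real.sinh (3 * v)) / 3)

/-- The unit normal of the timelike Enneper surface. -/
def EnneperTNormal (u v : ℝ) : ℝ × ℝ × ℝ :=
  (Real.exp (2 * u) * (1 + Real.exp (2 * u)) ^ 2)⁻¹ •
    lcross (pu EnneperT u v) (pv EnneperT u v)

lemma hd_exp (k u : ℝ) : HasDerivAt (fun t => Real.exp (k * t)) (k * Real.exp (k * u)) u := by
  have h := ((hasDerivAt_id u).const_mul k).exp
  simp only [id, mul_one] at h
  rwa [mul_comm] at h

lemma hd_cosh (k u : ℝ) : HasDerivAt (fun t => Real.cosh (k * t)) (k * Real.sinh (k * u)) u := by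
  have h := ((hasDerivAt_id u).const_mul k).cosh
  simp only [id, mul_one] at h
  rwa [mul_comm] at h

lemma hd_sinh (k u : ℝ) : HasDerivAt (fun t => Real.sinh (k * t)) (k * Real.cosh (k * u)) u := by
  have h := ((hasDerivAt_id u).const_mul k).sinh
  simp only [id, mul_one] at h
  rwa [mul_comm] at h

lemma exp_three (u : ℝ) : Real.exp (3 * u) = Real.exp u * Real.exp (2 * u) := by
  rw [← Real.exp_add]; ring_nf

lemma pu_E : pu EnneperT = fun u v =>
    (2 * Real.exp (2 * u) * Real.cosh (2 * v),
     Real.exp u * Real.cosh v - Real.exp (3 * u) * Real.cosh (3 * v),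
     Real.exp u * Real.sinh v + Real.exp (3 * u) * Real.sinh (3 * v)) := by
  funext u v
  have h1 := Real.hasDerivAt_exp u
  have h2 := hd_exp 2 u
  refine HasDerivAt.deriv (HasDerivAt.prodMk (h2.mul_const _) (HasDerivAt.prodMk ?_ ?_))
  · refine ((h1.mul ((h2.mul_const (Real.cosh (3 * v))).const_sub
      (3 * Real.cosh v))).div_const 3).congr_deriv ?_
    rw [exp_three]; ring
  · refine ((h1.mul ((h2.mul_const (Real.sinh (3 * v))).const_add
      (3 * Real.sinh v))).div_const 3).congr_deriv ?_
    rw [exp_three]; ring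

lemma pv_E : pv EnneperT = fun u v =>
    (2 * Real.exp (2 * u) * Real.sinh (2 * v),
     Real.exp u * Real.sinh v - Real.exp (3 * u) * Real.sinh (3 * v),
     Real.exp u * Real.cosh v + Real.exp (3 * u) * Real.cosh (3 * v)) := by
  funext u v
  have h1 := Real.hasDerivAt_cosh v
  have h2 := Real.hasDerivAt_sinh v
  refine HasDerivAt.deriv (HasDerivAt.prodMk
    (((hd_cosh 2 v).const_mul _).congr_deriv (by ring)) (HasDerivAt.prodMk ?_ ?_))
  · refine ((((h1.const_mul 3).sub ((hd_cosh 3 v).const_mul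
      (Real.exp (2 * u)))).const_mul (Real.exp u)).div_const 3).congr_deriv ?_
    rw [exp_three]; ring
  · refine ((((h2.const_mul 3).add ((hd_sinh 3 v).const_mul
      (Real.exp (2 * u)))).const_mul (Real.exp u)).div_const 3).congr_deriv ?_
    rw [exp_three]; ring

lemma puu_E (u v : ℝ) : pu (pu EnneperT) u v =
    (4 * Real.exp (2 * u) * Real.cosh (2 * v),
     Real.exp u * Real.cosh v - 3 * Real.exp (3 * u) * Real.cosh (3 * v),
     Real.exp u * Real.sinh v + 3 * Real.exp (3 * u) * Real.sinh (3 * v)) := by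
  rw [pu_E]
  have h1 := Real.hasDerivAt_exp u
  have h2 := hd_exp 2 u
  have h3 := hd_exp 3 u
  exact HasDerivAt.deriv (HasDerivAt.prodMk
    (((h2.const_mul 2).mul_const _).congr_deriv (by ring)) (HasDerivAt.prodMk
      ((h1.mul_const _).sub (h3.mul_const _)) ((h1.mul_const _).add (h3.mul_const _))))

lemma puv_E (u v : ℝ) : pv (pu EnneperT) u v =
    (4 * Real.exp (2 * u) * Real.sinh (2 * v),
     Real.exp u * Real.sinh v - 3 * Real.exp (3 * u) * Real.sinh (3 * v),
     Real.exp u * Real.cosh v + 3 * Real.exp (3 * u) * Real.cosh (3 * v)) := by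
  rw [pu_E]
  have h1 := Real.hasDerivAt_cosh v
  have h2 := Real.hasDerivAt_sinh v
  exact HasDerivAt.deriv (HasDerivAt.prodMk
    (((hd_cosh 2 v).const_mul _).congr_deriv (by ring)) (HasDerivAt.prodMk
      (((h1.const_mul _).sub ((hd_cosh 3 v).const_mul _)).congr_deriv (by ring))
      (((h2.const_mul _).add ((hd_sinh 3 v).const_mul _)).congr_deriv (by ring))))

lemma pvv_E (u v : ℝ) : pv (pv EnneperT) u v =
    (4 * Real.exp (2 * u) * Real.cosh (2 * v),
     Real.exp u * Real.cosh v - 3 * Real.exp (3 * u) * Real.cosh (3 * v),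
     Real.exp u * Real.sinh v + 3 * Real.exp (3 * u) * Real.sinh (3 * v)) := by
  rw [pv_E]
  have h1 := Real.hasDerivAt_cosh v
  have h2 := Real.hasDerivAt_sinh v
  exact HasDerivAt.deriv (HasDerivAt.prodMk
    (((hd_sinh 2 v).const_mul _).congr_deriv (by ring)) (HasDerivAt.prodMk
      (((h2.const_mul _).sub ((hd_sinh 3 v).const_mul _)).congr_deriv (by ring))
      (((h1.const_mul _).add ((hd_cosh 3 v).const_mul _)).congr_deriv (by ring))))

lemma exp_dbl (u : ℝ) : Real.exp (2 * u) = Real.exp u ^ 2 := by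
  rw [sq, ← Real.exp_add]; ring_nf

lemma normal_E (u v : ℝ) : EnneperTNormal u v =
    ((1 - Real.exp u ^ 2) / (1 + Real.exp u ^ 2),
     -(2 * Real.exp u * Real.cosh v) / (1 + Real.exp u ^ 2),
     2 * Real.exp u * Real.sinh v / (1 + Real.exp u ^ 2)) := by
  have ha := Real.exp_pos u
  have hc := Real.cosh_sq v
  have h3 := Real.cosh_sq (3 * v)
  have e1 : Real.cosh v = Real.cosh (3 * v) * Real.cosh (2 * v)
      - Real.sinh (3 * v) * Real.sinh (2 * v) := by rw [← Real.cosh_sub]; ring_nf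
  have e2 : Real.sinh v = Real.sinh (3 * v) * Real.cosh (2 * v)
      - Real.cosh (3 * v) * Real.sinh (2 * v) := by rw [← Real.sinh_sub]; ring_nf
  have e3 : Real.cosh v = Real.cosh (2 * v) * Real.cosh v
      - Real.sinh (2 * v) * Real.sinh v := by rw [← Real.cosh_sub]; ring_nf
  have e4 : Real.sinh v = Real.sinh (2 * v) * Real.cosh v
      - Real.cosh (2 * v) * Real.sinh v := by rw [← Real.sinh_sub]; ring_nf
  simp only [EnneperTNormal, pu_E, pv_E, lcross, exp_three, exp_dbl, Prod.smul_mk, smul_eq_mul]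
  generalize Real.exp u = a at *
  generalize Real.cosh v = c at *
  generalize Real.sinh v = s at *
  generalize Real.cosh (2 * v) = C2 at *
  generalize Real.sinh (2 * v) = S2 at *
  generalize Real.cosh (3 * v) = C3 at *
  generalize Real.sinh (3 * v) = S3 at *
  have hp : (0:ℝ) < 1 + a ^ 2 := by positivity
  refine Prod.ext ?_ (Prod.ext ?_ ?_) <;> simp only <;>
    rw [inv_mul_eq_div, div_eq_div_iff (by positivity) (by positivity)]
  · linear_combination (1 + a ^ 2) * (a ^ 2 * hc - a ^ 6 * h3)
  · linear_combination (1 + a ^ 2) * (2 * a ^ 3) * (e3 + a ^ 2 * e1)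
  · linear_combination (1 + a ^ 2) * (-2 * a ^ 3) * (e4 + a ^ 2 * e2)

/-- The unit normal and second fundamental form of the timelike Enneper surface:
the normal is unit spacelike, orthogonal to the tangent vectors, and the second
fundamental form coefficients are
`e = 2e^{2u}cosh 2v`, `f = 2e^{2u}sinh 2v`, `g = 2e^{2u}cosh 2v`. -/
theorem stmt3 (u v : ℝ) :
    lint (EnneperTNormal u v) (EnneperTNormal u v) = 1 ∧
    lint (EnneperTNormal u v) (pu EnneperT u v) = 0 ∧
    lint (EnneperTNormal u v) (pv EnneperT u v) = 0 ∧
    lint (pu (pu EnneperT) u v) (EnneperTNormal u v)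
        = 2 * Real.exp (2 * u) * Real.cosh (2 * v) ∧
    lint (pv (pu EnneperT) u v) (EnneperTNormal u v)
        = 2 * Real.exp (2 * u) * Real.sinh (2 * v) ∧
    lint (pv (pv EnneperT) u v) (EnneperTNormal u v)
        = 2 * Real.exp (2 * u) * Real.cosh (2 * v) := by
  have ha := Real.exp_pos u
  have hc := Real.cosh_sq v
  simp only [normal_E, puu_E, puv_E, pvv_E]
  simp only [pu_E, pv_E, lint, exp_three, exp_dbl, Real.cosh_two_mul, Real.sinh_two_mul,
    Real.cosh_three_mul, Real.sinh_three_mul]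
  generalize Real.exp u = a at *
  generalize Real.cosh v = c at *
  generalize Real.sinh v = s at *
  have hp : (1 + a ^ 2) ≠ 0 := by positivity
  have h4 : c ^ 4 = (s ^ 2 + 1) ^ 2 := by rw [← hc]; ring
  have h3 : c ^ 3 = c * (s ^ 2 + 1) := by rw [← hc]; ring
  refine ⟨?_, ?_, ?_, ?_, ?_, ?_⟩ <;> field_simp <;> ring_nf <;> simp only [h4, h3, hc] <;> ring
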